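/- arXiv:1803.02582 — 5 statements merged into one kernel-verified Lean document; each statement's English description precedes it below -/
import Mathlib

section
/- Let R be a commutative Noetherian ring, M a finitely generated R-module, and I an ideal of R generated by an M-regular sequence. Then for every ideal a in S_{(I;M)}, every associated prime of the R-module R/a is an associated prime of the R-module M/IM, i.e. Ass_R(R/a) ⊆ Ass_R(M/IM). -/
/-- The colon submodule `N :_M a = { m : M | a • m ⊆ N }`. -/
def Submodule.colonSubmodule {R M : Type*} [CommRing R] [AddCommGroup M] [Module R M]
    (N : Submodule R M) (a : Ideal R) : Submodule R M where
  carrier := {m | ∀ r ∈ a, r • m ∈ N}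
  add_mem' := fun hx hy r hr => by
    rw [smul_add]; exact N.add_mem (hx r hr) (hy r hr)
  zero_mem' := fun r hr => by rw [smul_zero]; exact N.zero_mem
  smul_mem' := fun c x hx r hr => by
    rw [smul_comm]; exact N.smul_mem c (hx r hr)

/-- `I` is generated by an `M`-regular sequence. -/
def Ideal.IsGenByRegularSequence (M : Type*) {R : Type*} [CommRing R] [AddCommGroup M]
    [Module R M] (I : Ideal R) : Prop :=
  ∃ rs : List R, RingTheory.Sequence.IsRegular M rs ∧ I = Ideal.ofList rs

/-- The set `S_{(I;M)}` of ideals `a` with `I ⊊ a` and `a = IM :_R (IM :_M a)`. -/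
def linkageSet (R M : Type*) [CommRing R] [AddCommGroup M] [Module R M] (I : Ideal R) :
    Set (Ideal R) :=
  {a | I < a ∧
    a = Submodule.colon (I • ⊤ : Submodule R M)
          (Submodule.colonSubmodule (I • ⊤ : Submodule R M) a)}

/-- If a prime is the annihilator of a finitely generated submodule, then it is the annihilator of
one of the elements of that submodule. -/
theorem Ideal.IsPrime.exists_eq_colon_singleton {R M : Type*} [CommRing R] [AddCommGroup M]
    [Module R M] {p : Ideal R} (hp : p.IsPrime) {L : Submodule R M} (hL : L.FG)
    (h : ∀ r, r ∈ p ↔ ∀ m ∈ L, r • m = 0) :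
    ∃ m ∈ L, p = (⊥ : Submodule R M).colon {m} := by
  obtain ⟨s, rfl⟩ := hL
  have hle : s.inf (fun m => (⊥ : Submodule R M).colon {m}) ≤ p := by
    intro r hr
    rw [Submodule.mem_finsetInf] at hr
    rw [h]
    intro m hm
    induction hm using Submodule.span_induction with
    | mem m hm => simpa [Submodule.mem_colon_singleton] using hr m hm
    | zero => exact smul_zero r
    | add m n _ _ hm hn => rw [smul_add, hm, hn, add_zero]
    | smul c m _ hm => rw [smul_comm, hm, smul_zero]
  obtain ⟨m, hm, hmp⟩ := (hp.inf_le').1 hle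
  refine ⟨m, Submodule.subset_span hm, le_antisymm (fun r hr => ?_) hmp⟩
  rw [Submodule.mem_colon_singleton, Submodule.mem_bot]
  exact (h r).1 hr m (Submodule.subset_span hm)

/-- The associated primes of `R ⧸ (N : L)` are associated primes of `M ⧸ N`. -/
theorem Submodule.associatedPrimes_quotient_colon_subset {R M : Type*} [CommRing R]
    [IsNoetherianRing R] [AddCommGroup M] [Module R M] [Module.Finite R M]
    (N L : Submodule R M) :
    associatedPrimes R (R ⧸ N.colon (L : Set M)) ⊆ associatedPrimes R (M ⧸ N) := by
  intro p hp
  rw [AssociatedPrimes.mem_iff, isAssociatedPrime_iff] at hp ⊢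
  obtain ⟨hprime, y, hy⟩ := hp
  obtain ⟨x, rfl⟩ := Ideal.Quotient.mk_surjective y
  have hmem : ∀ r, r ∈ p ↔ ∀ m ∈ L.map (x • N.mkQ), r • m = 0 := by
    intro r
    have hr : r • Ideal.Quotient.mk (N.colon (L : Set M)) x
        = Ideal.Quotient.mk (N.colon (L : Set M)) (r * x) := rfl
    rw [hy, Submodule.mem_colon_singleton, Submodule.mem_bot, hr, Ideal.Quotient.eq_zero_iff_mem,
      Submodule.mem_colon]
    simp only [Submodule.mem_map, forall_exists_index, and_imp, forall_apply_eq_imp_iff₂,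
      LinearMap.smul_apply, SetLike.mem_coe]
    refine forall₂_congr fun m _ => ?_
    rw [smul_smul, ← map_smul, Submodule.mkQ_apply, Submodule.Quotient.mk_eq_zero]
  obtain ⟨m, -, hm⟩ := hprime.exists_eq_colon_singleton (IsNoetherian.noetherian _) hmem
  exact ⟨hprime, m, hm⟩

/-- For every ideal `a ∈ S_{(I;M)}`, every associated prime of `R/a` is an
associated prime of `M/IM`. -/
theorem stmt_0 {R M : Type*} [CommRing R] [IsNoetherianRing R] [AddCommGroup M] [Module R M]
    [Module.Finite R M] (I : Ideal R) (hI : I.IsGenByRegularSequence M) :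
    ∀ a ∈ linkageSet R M I,
      associatedPrimes R (R ⧸ a) ⊆
        associatedPrimes R (M ⧸ (I • ⊤ : Submodule R M)) := by
  rintro a ⟨-, ha⟩
  rw [ha]
  exact Submodule.associatedPrimes_quotient_colon_subset _ _
end

section
/- Let R be a commutative Noetherian ring, M a finitely generated R-module, and I an ideal of R generated by an M-regular sequence. Then a prime ideal p of R belongs to S_{(I;M)} if and only if p is an associated prime of M/IM and p ≠ I; that is, Ass_R(M/IM) \ {I} is exactly the set of prime ideals lying in S_{(I;M)}. -/
/-- A prime is associated to `M ⧸ N` iff it is the set of multipliers of some `m` into `N`. -/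
theorem mem_associatedPrimes_quotient_iff {R M : Type*} [CommRing R] [IsNoetherianRing R]
    [AddCommGroup M] [Module R M] (N : Submodule R M) (p : Ideal R) :
    p ∈ associatedPrimes R (M ⧸ N) ↔ p.IsPrime ∧ ∃ m : M, ∀ r, r ∈ p ↔ r • m ∈ N := by
  rw [AssociatedPrimes.mem_iff, isAssociatedPrime_iff, and_congr_right_iff]
  intro _
  rw [N.mkQ_surjective.exists]
  refine exists_congr fun m => ?_
  rw [SetLike.ext_iff]
  refine forall_congr' fun r => ?_
  rw [Submodule.mem_colon_singleton, Submodule.mem_bot, ← map_smul, Submodule.mkQ_apply,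
    Submodule.Quotient.mk_eq_zero]

/-- A prime which is the colon ideal of `N` by a finitely generated submodule is the colon ideal
of `N` by a single element. -/
theorem Submodule.exists_colon_of_fg_of_isPrime {R M : Type*} [CommRing R]
    [AddCommGroup M] [Module R M] (N K : Submodule R M) (hK : K.FG) {p : Ideal R}
    (hp : p.IsPrime) (h : p = N.colon (K : Set M)) : ∃ m ∈ K, ∀ r, r ∈ p ↔ r • m ∈ N := by
  obtain ⟨s, rfl⟩ := hK
  have hle : s.inf (fun m => N.colon {m}) ≤ p := by
    intro r hr
    rw [h, Submodule.mem_colon]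
    have hs : Submodule.span R (s : Set M) ≤ N.comap (LinearMap.lsmul R M r) :=
      Submodule.span_le.2 fun m hm =>
        Submodule.mem_colon_singleton.1 (Finset.inf_le (f := fun m => N.colon {m}) hm hr)
    exact fun m hm => hs hm
  obtain ⟨m, hm, hmp⟩ := (Ideal.IsPrime.inf_le' hp).1 hle
  have hmK := Submodule.subset_span (R := R) hm
  refine ⟨m, hmK, fun r => ⟨fun hr => ?_, fun hr => hmp (Submodule.mem_colon_singleton.2 hr)⟩⟩
  rw [h] at hr
  exact Submodule.mem_colon.1 hr m hmK

/-- The primes in `linkageSet R M I` are the associated primes of `M ⧸ I • ⊤` other than `I`. -/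
theorem mem_linkageSet_iff_of_isPrime {R M : Type*} [CommRing R] [IsNoetherianRing R]
    [AddCommGroup M] [Module R M] [Module.Finite R M] (I p : Ideal R) (hp : p.IsPrime) :
    p ∈ linkageSet R M I ↔
      p ∈ associatedPrimes R (M ⧸ (I • ⊤ : Submodule R M)) ∧ p ≠ I := by
  rw [mem_associatedPrimes_quotient_iff]
  constructor
  · rintro ⟨hlt, heq⟩
    obtain ⟨m, -, hm⟩ := Submodule.exists_colon_of_fg_of_isPrime _ _
      (IsNoetherian.noetherian _) hp heq
    exact ⟨⟨hp, m, hm⟩, hlt.ne'⟩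
  · rintro ⟨⟨-, m, hm⟩, hne⟩
    refine ⟨lt_of_le_of_ne (fun r hr => (hm r).2 ?_) hne.symm, le_antisymm ?_ ?_⟩
    · exact Submodule.smul_mem_smul hr Submodule.mem_top
    · exact fun r hr => Submodule.mem_colon.2 fun x hx => hx r hr
    · exact fun r hr => (hm r).2 (Submodule.mem_colon.1 hr m fun t ht => (hm t).1 ht)

/-- A prime ideal `p` belongs to `S_{(I;M)}` iff `p` is an associated prime of
`M/IM` different from `I`; that is, `Ass_R(M/IM) \ {I}` is exactly the set of prime ideals
lying in `S_{(I;M)}`. -/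
theorem stmt_1 {R M : Type*} [CommRing R] [IsNoetherianRing R] [AddCommGroup M] [Module R M]
    [Module.Finite R M] (I : Ideal R) (hI : I.IsGenByRegularSequence M) :
    (∀ p : Ideal R, p.IsPrime →
      (p ∈ linkageSet R M I ↔
        p ∈ associatedPrimes R (M ⧸ (I • ⊤ : Submodule R M)) ∧ p ≠ I)) ∧
    associatedPrimes R (M ⧸ (I • ⊤ : Submodule R M)) \ {I} =
      {p | p ∈ linkageSet R M I ∧ p.IsPrime} := by
  refine ⟨fun p hp => mem_linkageSet_iff_of_isPrime I p hp, Set.ext fun p => ?_⟩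
  constructor
  · exact fun h => ⟨(mem_linkageSet_iff_of_isPrime I p h.1.isPrime).2 h, h.1.isPrime⟩
  · exact fun h => (mem_linkageSet_iff_of_isPrime I p h.2).1 h.1
end

section
/- Let R be a commutative Noetherian ring, M a finitely generated R-module, and I an ideal of R generated by an M-regular sequence. If a₁ and a₂ belong to S_{(I;M)} and a₁ ∩ a₂ ≠ I, then a₁ ∩ a₂ belongs to S_{(I;M)}. -/
theorem Submodule.colonSubmodule_anti {R M : Type*} [CommRing R] [AddCommGroup M] [Module R M]
    (N : Submodule R M) {a b : Ideal R} (hab : a ≤ b) :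
    N.colonSubmodule b ≤ N.colonSubmodule a :=
  fun _ hm r hr => hm r (hab hr)

theorem Submodule.le_colon_colonSubmodule {R M : Type*} [CommRing R] [AddCommGroup M]
    [Module R M] (N : Submodule R M) (a : Ideal R) :
    a ≤ N.colon (N.colonSubmodule a) :=
  fun r hr => Submodule.mem_colon.2 fun _ hm => hm r hr

/-- `S_{(I;M)}` is closed under (non-trivial) finite intersections. -/
theorem stmt_2 {R M : Type*} [CommRing R] [IsNoetherianRing R] [AddCommGroup M] [Module R M]
    [Module.Finite R M] (I : Ideal R) (hI : I.IsGenByRegularSequence M)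
    (a₁ a₂ : Ideal R) (h₁ : a₁ ∈ linkageSet R M I) (h₂ : a₂ ∈ linkageSet R M I)
    (h : a₁ ⊓ a₂ ≠ I) :
    a₁ ⊓ a₂ ∈ linkageSet R M I := by
  obtain ⟨hlt₁, heq₁⟩ := h₁
  obtain ⟨hlt₂, heq₂⟩ := h₂
  refine ⟨lt_of_le_of_ne (le_inf hlt₁.le hlt₂.le) h.symm,
    le_antisymm (Submodule.le_colon_colonSubmodule _ _) (le_inf ?_ ?_)⟩
  · exact (Submodule.colon_mono le_rfl (Submodule.colonSubmodule_anti _ inf_le_left)).trans heq₁.ge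
  · exact (Submodule.colon_mono le_rfl (Submodule.colonSubmodule_anti _ inf_le_right)).trans heq₂.ge
end

section
/- Let R be a commutative Noetherian ring, M a finitely generated R-module, and I an ideal of R generated by an M-regular sequence. If a belongs to S_{(I;M)}, then its radical √a also belongs to S_{(I;M)}, and moreover √a = ⋂_{p ∈ Λ} p for some subset Λ of Ass_R(M/IM) \ {I}. -/
theorem Submodule.annihilator_map_mkQ {R M : Type*} [CommRing R] [AddCommGroup M] [Module R M]
    (N P : Submodule R M) : (P.map N.mkQ).annihilator = N.colon P := by
  ext r
  simp only [Submodule.mem_annihilator, Submodule.mem_colon, Submodule.mem_map,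
    forall_exists_index, and_imp, forall_apply_eq_imp_iff₂, SetLike.mem_coe]
  refine forall₂_congr fun x _ => ?_
  rw [← map_smul, Submodule.mkQ_apply, Submodule.Quotient.mk_eq_zero]

/-- A minimal prime of `N :_R P` is the annihilator in `M ⧸ N` of the class of an element
of `P`. -/
theorem Submodule.exists_mem_eq_colon_of_mem_minimalPrimes_colon {R M : Type*} [CommRing R]
    [IsNoetherianRing R] [AddCommGroup M] [Module R M] [Module.Finite R M]
    (N P : Submodule R M) {p : Ideal R} (hp : p ∈ (N.colon (P : Set M)).minimalPrimes) :
    ∃ x ∈ P, p = N.colon {x} := by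
  have hp' : p ∈ associatedPrimes R (P.map N.mkQ) := by
    apply Module.associatedPrimes.minimalPrimes_annihilator_subset_associatedPrimes
    rwa [← Submodule.annihilator_map_mkQ] at hp
  obtain ⟨-, ⟨_, x, hx, rfl⟩, rfl⟩ := isAssociatedPrime_iff.1 hp'
  refine ⟨x, hx, ?_⟩
  ext r
  rw [Submodule.mem_colon_singleton, Submodule.mem_colon_singleton, Submodule.mem_bot,
    ← Submodule.coe_eq_zero, Submodule.coe_smul, ← map_smul, Submodule.mkQ_apply,
    Submodule.Quotient.mk_eq_zero]

theorem Submodule.mem_associatedPrimes_quotient_of_eq_colon {R M : Type*} [CommRing R]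
    [IsNoetherianRing R] [AddCommGroup M] [Module R M] (N : Submodule R M) {p : Ideal R}
    [hp : p.IsPrime] {x : M} (h : p = N.colon {x}) : p ∈ associatedPrimes R (M ⧸ N) := by
  refine isAssociatedPrime_iff.2 ⟨hp, N.mkQ x, ?_⟩
  ext r
  rw [h, Submodule.mem_colon_singleton, Submodule.mem_colon_singleton, Submodule.mem_bot,
    ← map_smul, Submodule.mkQ_apply, Submodule.Quotient.mk_eq_zero]

/-- `S_{(I;M)}` is closed under radicals; moreover the radical of any member is
an intersection of associated primes of `M/IM` different from `I`. -/
theorem stmt_3 {R M : Type*} [CommRing R] [IsNoetherianRing R] [AddCommGroup M] [Module R M]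
    [Module.Finite R M] (I : Ideal R) (hI : I.IsGenByRegularSequence M)
    (a : Ideal R) (ha : a ∈ linkageSet R M I) :
    a.radical ∈ linkageSet R M I ∧
      ∃ Λ ⊆ associatedPrimes R (M ⧸ (I • ⊤ : Submodule R M)) \ {I},
        a.radical = sInf Λ := by
  obtain ⟨hlt, heq⟩ := ha
  set N : Submodule R M := I • ⊤
  have key : ∀ p ∈ a.minimalPrimes, ∃ x, p = N.colon {x} := fun p hp => by
    rw [heq] at hp
    obtain ⟨x, -, hx⟩ := N.exists_mem_eq_colon_of_mem_minimalPrimes_colon _ hp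
    exact ⟨x, hx⟩
  refine ⟨⟨hlt.trans_le Ideal.le_radical, le_antisymm ?_ ?_⟩, a.minimalPrimes, ?_,
    a.sInf_minimalPrimes.symm⟩
  · exact fun r hr => Submodule.mem_colon.2 fun x hx => hx r hr
  · intro r hr
    rw [← a.sInf_minimalPrimes, Submodule.mem_sInf]
    intro p hp
    obtain ⟨x, rfl⟩ := key p hp
    refine Submodule.mem_colon_singleton.2 (Submodule.mem_colon.1 hr x fun s hs => ?_)
    exact Submodule.mem_colon_singleton.1 (hp.1.1.radical_le_iff.2 hp.1.2 hs)
  · intro p hp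
    obtain ⟨x, hx⟩ := key p hp
    have := hp.1.1
    refine ⟨N.mem_associatedPrimes_quotient_of_eq_colon hx, ?_⟩
    rintro rfl
    exact hlt.not_ge hp.1.2
end

section
/- Let (R, m) be a commutative Noetherian local ring and M a finitely generated R-module such that Ass_R M = Min Ass_R M (M has no embedded associated primes). Then the following are equivalent: (i) M is a Cohen-Macaulay module; (ii) for every ideal a of R that is linked with respect to M (i.e. there exist an ideal b and an ideal I generated by an M-regular sequence with a ~_{(I;M)} b), the module M/aM is unmixed, meaning dim R/p = dim M/aM for every p ∈ Ass_R(M/aM). -/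
/-- The ideals `a` and `b` are linked by `I` with respect to `M`: `aM ≠ M`, `bM ≠ M`,
`I ⊆ a ∩ b`, `I` is generated by an `M`-regular sequence, `bM = IM :_M a` and
`aM = IM :_M b`. -/
def LinkedByWrt {R : Type*} [CommRing R] (M : Type*) [AddCommGroup M] [Module R M]
    (a b I : Ideal R) : Prop :=
  a • (⊤ : Submodule R M) ≠ ⊤ ∧ b • (⊤ : Submodule R M) ≠ ⊤ ∧ I ≤ a ⊓ b ∧
    I.IsGenByRegularSequence M ∧
    b • (⊤ : Submodule R M) = Submodule.colonSubmodule (I • ⊤ : Submodule R M) a ∧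
    a • (⊤ : Submodule R M) = Submodule.colonSubmodule (I • ⊤ : Submodule R M) b

/-- The depth of a module `M` over a local ring `R`: the supremum of lengths of `M`-regular
sequences contained in the maximal ideal. -/
noncomputable def moduleDepth (R M : Type*) [CommRing R] [IsLocalRing R] [AddCommGroup M]
    [Module R M] : ℕ∞ :=
  sSup {n : ℕ∞ | ∃ rs : List R, (rs.length : ℕ∞) = n ∧
    (∀ x ∈ rs, x ∈ IsLocalRing.maximalIdeal R) ∧ RingTheory.Sequence.IsRegular M rs}

/-- The dimension of a module `M` over `R`: the Krull dimension of `R/Ann M`. -/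
noncomputable def moduleDim (R M : Type*) [CommRing R] [AddCommGroup M] [Module R M] :
    WithBot ℕ∞ :=
  ringKrullDim (R ⧸ Module.annihilator R M)

/-- A module over a local ring is Cohen–Macaulay if it is zero or its depth equals its
dimension. -/
def IsCohenMacaulayModule (R M : Type*) [CommRing R] [IsLocalRing R] [AddCommGroup M]
    [Module R M] : Prop :=
  Subsingleton M ∨ moduleDim R M = (moduleDepth R M : WithBot ℕ∞)

section RegularSequence

open RingTheory.Sequence IsLocalRing Pointwise

universe u v

open CategoryTheory Abelian in
/-- Dividing a module by a regular element lowers the length of the available regular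
sequences in `J` by at most one, whichever regular element is chosen. -/
theorem ModuleCat.exists_isRegular_quotSMulTop {R : Type*} [CommRing R] [IsNoetherianRing R]
    [Small.{v} R] (J : Ideal R) (M : ModuleCat.{v} R) [Module.Finite R M] {x : R}
    (hx : IsSMulRegular M x) (hlt : J • (⊤ : Submodule R M) < ⊤)
    (hltx : J • (⊤ : Submodule R (QuotSMulTop x M)) < ⊤) {n : ℕ}
    (h : ∃ rs : List R, rs.length = n + 1 ∧ (∀ r ∈ rs, r ∈ J) ∧ IsRegular M rs) :
    ∃ rs : List R, rs.length = n ∧ (∀ r ∈ rs, r ∈ J) ∧ IsRegular (QuotSMulTop x M) rs := by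
  refine ((ModuleCat.of R (QuotSMulTop x M)).exists_isRegular_tfae J n hltx).out 1 3 |>.mp ?_
  have hext := (M.exists_isRegular_tfae J (n + 1) hlt).out 1 3 |>.mpr h
  intro i hi
  have zero1 := AddCommGrpCat.isZero_of_iff_subsingleton.mpr (hext i (by omega))
  have zero2 := AddCommGrpCat.isZero_of_iff_subsingleton.mpr (hext (i + 1) (by omega))
  exact AddCommGrpCat.subsingleton_of_isZero <| ShortComplex.Exact.isZero_of_both_zeros
    ((Ext.covariant_sequence_exact₃' _ hx.smulShortComplex_shortExact) i (i + 1) rfl)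
    (zero1.eq_zero_of_src _) (zero2.eq_zero_of_tgt _)

variable {R : Type u} [CommRing R]

theorem maximalIdeal_smul_top_lt_top [IsLocalRing R] (N : Type*) [AddCommGroup N] [Module R N]
    [Module.Finite R N] [Nontrivial N] : maximalIdeal R • (⊤ : Submodule R N) < ⊤ :=
  (Submodule.top_ne_ideal_smul_of_le_jacobson_annihilator
    (maximalIdeal_le_jacobson _)).symm.lt_top

theorem ringKrullDim_quotient_le_supportDim [IsNoetherianRing R] {M : Type*} [AddCommGroup M]
    [Module R M] {p : Ideal R} (hp : p ∈ associatedPrimes R M) :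
    ringKrullDim (R ⧸ p) ≤ Module.supportDim R M := by
  rw [← Module.supportDim_quotient_eq_ringKrullDim]
  obtain ⟨-, f, hf⟩ := (isAssociatedPrime_iff_exists_injective_linearMap p M).mp hp
  exact Module.supportDim_le_of_injective f hf

variable [IsNoetherianRing R] [IsLocalRing R]

theorem exists_isRegular_quotSMulTop {M : Type*} [AddCommGroup M] [Module R M]
    [Module.Finite R M] {x : R} (hxm : x ∈ maximalIdeal R) (hx : IsSMulRegular M x) {n : ℕ}
    (h : ∃ rs : List R, rs.length = n + 1 ∧ (∀ r ∈ rs, r ∈ maximalIdeal R) ∧ IsRegular M rs) :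
    ∃ rs : List R, rs.length = n ∧ (∀ r ∈ rs, r ∈ maximalIdeal R) ∧
      IsRegular (QuotSMulTop x M) rs := by
  let e : ULift.{u} M ≃ₗ[R] M := ULift.moduleEquiv
  obtain ⟨rs, hlen, hmem, hreg⟩ := h
  have := hreg.nontrivial
  have : Nontrivial (QuotSMulTop x (ULift.{u} M)) := nontrivial_quotSMulTop_of_mem_maximalIdeal _ hxm
  obtain ⟨rs', hlen', hmem', hreg'⟩ := ModuleCat.exists_isRegular_quotSMulTop (maximalIdeal R)
    (ModuleCat.of R (ULift.{u} M)) ((e.isSMulRegular_congr x).mpr hx)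
    (maximalIdeal_smul_top_lt_top _) (maximalIdeal_smul_top_lt_top (QuotSMulTop x (ULift.{u} M)))
    ⟨rs, hlen, hmem, (e.isRegular_congr rs).mpr hreg⟩
  exact ⟨rs', hlen', hmem', ((QuotSMulTop.congr x e).isRegular_congr rs').mp hreg'⟩

theorem exists_isRegular_quotient_ofList_smul_top {M : Type*} [AddCommGroup M] [Module R M]
    [Module.Finite R M] {xs : List R} (hxs : ∀ r ∈ xs, r ∈ maximalIdeal R)
    (hreg : IsRegular M xs) {n : ℕ}
    (h : ∃ rs : List R, rs.length = n + xs.length ∧ (∀ r ∈ rs, r ∈ maximalIdeal R) ∧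
      IsRegular M rs) :
    ∃ rs : List R, rs.length = n ∧ (∀ r ∈ rs, r ∈ maximalIdeal R) ∧
      IsRegular (M ⧸ (Ideal.ofList xs • ⊤ : Submodule R M)) rs := by
  induction xs generalizing M with
  | nil =>
    obtain ⟨rs, hlen, hmem, hrs⟩ := h
    have e := (Submodule.quotEquivOfEqBot (Ideal.ofList ([] : List R) • ⊤ : Submodule R M)
      (by simp))
    exact ⟨rs, hlen, hmem, (e.isRegular_congr rs).mpr hrs⟩
  | cons x xs ih =>
    rw [isRegular_cons_iff] at hreg
    obtain ⟨rs, hlen, hmem, hrs⟩ := ih (fun r hr => hxs r (List.mem_cons_of_mem _ hr)) hreg.2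
      (exists_isRegular_quotSMulTop (hxs x List.mem_cons_self) hreg.1 h)
    exact ⟨rs, hlen, hmem, ((Submodule.quotOfListConsSMulTopEquivQuotSMulTopInner M x
      xs).isRegular_congr rs).mpr hrs⟩

theorem exists_associatedPrime_quotSMulTop_sup_le {M : Type*} [AddCommGroup M] [Module R M]
    [Module.Finite R M] {x : R} (hxm : x ∈ maximalIdeal R) (hx : IsSMulRegular M x) {p : Ideal R}
    (hp : p ∈ associatedPrimes R M) :
    ∃ q ∈ associatedPrimes R (QuotSMulTop x M), p ≤ q ∧ x ∈ q := by
  obtain ⟨u, hu, hux⟩ : ∃ u : M, (∀ r ∈ p, r • u = 0) ∧ u ∉ x • (⊤ : Submodule R M) := by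
    by_contra! hcon
    let K : Submodule R M := Submodule.colonSubmodule ⊥ p
    have hK : K ≤ Ideal.span {x} • K := by
      intro u hu
      obtain ⟨v, -, rfl⟩ := (Submodule.mem_smul_pointwise_iff_exists _ _ _).mp (hcon u hu)
      refine Submodule.smul_mem_smul (Ideal.mem_span_singleton_self x) fun r hr => ?_
      exact hx.right_eq_zero_of_smul (by rw [smul_comm]; exact hu r hr)
    have hbot := Submodule.eq_bot_of_le_smul_of_le_jacobson_bot _ _ (IsNoetherian.noetherian K) hK
      (((Ideal.span_singleton_le_iff_mem _).mpr hxm).trans (maximalIdeal_le_jacobson _))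
    obtain ⟨hprime, u, rfl⟩ := isAssociatedPrime_iff.mp hp
    have huK : u ∈ K := fun r hr => by simpa using Submodule.mem_colon_singleton.mp hr
    rw [hbot, Submodule.mem_bot] at huK
    exact hprime.ne_top (by simp [huK])
  obtain ⟨q, hq, hle⟩ := exists_le_isAssociatedPrime_of_isNoetherianRing R
    (Submodule.Quotient.mk u : QuotSMulTop x M)
    (by rwa [Ne, Submodule.Quotient.mk_eq_zero])
  refine ⟨q, hq, fun r hr => hle ?_, hle ?_⟩ <;>
    rw [Submodule.mem_colon_singleton, Submodule.mem_bot, ← Submodule.Quotient.mk_smul,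
      Submodule.Quotient.mk_eq_zero]
  · rw [hu r hr]; exact zero_mem _
  · exact Submodule.smul_mem_pointwise_smul _ _ _ trivial

/-- The length of a regular sequence is bounded by the dimension of every associated prime. -/
theorem length_le_ringKrullDim_quotient_of_mem_associatedPrimes {M : Type*} [AddCommGroup M]
    [Module R M] [Module.Finite R M] {rs : List R} (hmem : ∀ r ∈ rs, r ∈ maximalIdeal R)
    (hreg : IsRegular M rs) {p : Ideal R} (hp : p ∈ associatedPrimes R M) :
    (rs.length : WithBot ℕ∞) ≤ ringKrullDim (R ⧸ p) := by
  induction rs generalizing M p with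
  | nil =>
    have := hp.isPrime
    simpa using ringKrullDim_nonneg_of_nontrivial
  | cons x rs ih =>
    rw [isRegular_cons_iff] at hreg
    have hxm := hmem x List.mem_cons_self
    obtain ⟨q, hq, hpq, hxq⟩ := exists_associatedPrime_quotSMulTop_sup_le hxm hreg.1 hp
    have hxp : x ∉ p := by
      intro hxp
      obtain ⟨hprime, u, rfl⟩ := isAssociatedPrime_iff.mp hp
      refine hprime.ne_top ?_
      have : u = 0 := hreg.1.right_eq_zero_of_smul (by simpa using hxp)
      simp [this]
    have := hp.isPrime
    have hdim := ringKrullDim_succ_le_of_surjective (Ideal.Quotient.factor hpq)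
      (Ideal.Quotient.factor_surjective hpq) (r := Ideal.Quotient.mk p x)
      (mem_nonZeroDivisors_of_ne_zero (by rwa [Ne, Ideal.Quotient.eq_zero_iff_mem]))
      (by simpa [Ideal.Quotient.eq_zero_iff_mem] using hxq)
    refine le_trans ?_ hdim
    have := ih (fun r hr => hmem r (List.mem_cons_of_mem _ hr)) hreg.2 hq
    push_cast [List.length_cons]
    gcongr

theorem exists_isSMulRegular_of_maximalIdeal_notMem_associatedPrimes {M : Type*} [AddCommGroup M]
    [Module R M] [Module.Finite R M] (h : maximalIdeal R ∉ associatedPrimes R M) :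
    ∃ x ∈ maximalIdeal R, IsSMulRegular M x := by
  by_contra! hcon
  obtain ⟨P, hP, hle⟩ := ((maximalIdeal R).subset_union_prime_finite (associatedPrimes.finite R M)
    (f := id) 0 0 fun _ h _ _ => h.isPrime).1 <| by
      simp_rw [id, biUnion_associatedPrimes_eq_compl_regular R M]
      exact fun x hx => hcon x hx
  exact h ((maximalIdeal.isMaximal R).eq_of_le hP.isPrime.ne_top hle ▸ hP)

/-- The ideal generated by a nonempty regular sequence is linked to itself. -/
theorem linkedByWrt_self_of_isRegular_append_singleton {R M : Type*} [CommRing R] [AddCommGroup M]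
    [Module R M] {rs : List R} {x : R} (h : IsRegular M (rs ++ [x])) :
    LinkedByWrt M (Ideal.ofList (rs ++ [x])) (Ideal.ofList (rs ++ [x]))
      (Ideal.ofList (rs ++ [x ^ 2])) := by
  have hle : Ideal.ofList (rs ++ [x ^ 2]) ≤ Ideal.ofList (rs ++ [x]) := by
    simp only [Ideal.ofList_append, Ideal.ofList_singleton]
    exact sup_le_sup_left
      (Ideal.span_singleton_le_span_singleton.mpr (dvd_pow_self x two_ne_zero)) _
  have hmul : Ideal.ofList (rs ++ [x]) * Ideal.ofList (rs ++ [x]) ≤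
      Ideal.ofList (rs ++ [x ^ 2]) := by
    simp only [Ideal.ofList_append, Ideal.ofList_singleton, Ideal.sup_mul, Ideal.mul_sup,
      Ideal.span_singleton_mul_span_singleton, sq x]
    exact sup_le (sup_le (Ideal.mul_le_left.trans le_sup_left)
      (Ideal.mul_le_right.trans le_sup_left))
      (sup_le (Ideal.mul_le_left.trans le_sup_left) le_sup_right)
  have hne := h.top_ne_smul.symm
  have hx : IsWeaklyRegular M rs ∧ IsSMulRegular (M ⧸ (Ideal.ofList rs • ⊤ : Submodule R M)) x := by
    simpa [isWeaklyRegular_append_iff, isWeaklyRegular_singleton_iff] using h.toIsWeaklyRegular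
  have hcolon : Ideal.ofList (rs ++ [x]) • (⊤ : Submodule R M) =
      Submodule.colonSubmodule (Ideal.ofList (rs ++ [x ^ 2]) • ⊤ : Submodule R M)
        (Ideal.ofList (rs ++ [x])) := by
    refine le_antisymm (fun m hm r hr => ?_) fun m hm => ?_
    · have := Submodule.smul_mem_smul hr hm
      rw [← mul_smul] at this
      exact Submodule.smul_mono_left hmul this
    · have hxm : x • m ∈ Ideal.ofList (rs ++ [x ^ 2]) • (⊤ : Submodule R M) :=
        hm x (Ideal.subset_span (by simp))
      simp only [Ideal.ofList_append, Ideal.ofList_singleton, Submodule.sup_smul,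
        Submodule.ideal_span_singleton_smul] at hxm ⊢
      obtain ⟨j, hj, y, hy, hjy⟩ := Submodule.mem_sup.mp hxm
      obtain ⟨n, -, rfl⟩ := (Submodule.mem_smul_pointwise_iff_exists _ _ _).mp hy
      have hsub : m - x • n ∈ Ideal.ofList rs • (⊤ : Submodule R M) := by
        refine (isSMulRegular_quotient_iff_mem_of_smul_mem _ _).mp hx.2 _ ?_
        rwa [smul_sub, ← mul_smul, ← sq, ← hjy, add_sub_cancel_right]
      rw [← sub_add_cancel m (x • n)]
      exact Submodule.add_mem_sup hsub (Submodule.smul_mem_pointwise_smul _ _ _ trivial)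
  refine ⟨hne, hne, le_inf hle hle, ⟨_, ⟨?_, ?_⟩, rfl⟩, hcolon, hcolon⟩
  · rw [isWeaklyRegular_append_iff, isWeaklyRegular_singleton_iff]
    exact ⟨hx.1, hx.2.pow 2⟩
  · exact (ne_top_of_le_ne_top hne (Submodule.smul_mono_left hle)).symm

theorem moduleDim_eq_supportDim (R M : Type*) [CommRing R] [AddCommGroup M] [Module R M]
    [Module.Finite R M] : moduleDim R M = Module.supportDim R M :=
  (Module.supportDim_eq_ringKrullDim_quotient_annihilator R M).symm

theorem RingTheory.Sequence.IsRegular.mem_maximalIdeal {R M : Type*} [CommRing R] [IsLocalRing R]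
    [AddCommGroup M] [Module R M] {rs : List R} (h : IsRegular M rs) {r : R} (hr : r ∈ rs) :
    r ∈ maximalIdeal R := by
  have hne : Ideal.ofList rs ≠ ⊤ := fun htop => h.top_ne_smul (by rw [htop, Submodule.top_smul])
  exact le_maximalIdeal hne (Ideal.subset_span hr)

section

variable {R : Type*} [CommRing R] [IsNoetherianRing R] [IsLocalRing R]

theorem exists_nat_eq_supportDim (M : Type*) [AddCommGroup M] [Module R M] [Nontrivial M] :
    ∃ d : ℕ, Module.supportDim R M = d := by
  have hlt : Module.supportDim R M < ⊤ :=
    (Module.supportDim_le_ringKrullDim R M).trans_lt ringKrullDim_lt_top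
  have hbot := Module.supportDim_ne_bot_of_nontrivial R M
  lift Module.supportDim R M to ℕ∞ using hbot with d
  lift d to ℕ using (by rintro rfl; exact hlt.ne rfl)
  exact ⟨d, rfl⟩

variable {M : Type*} [AddCommGroup M] [Module R M] [Module.Finite R M]

theorem length_le_supportDim_of_isRegular {rs : List R} (h : IsRegular M rs) :
    (rs.length : WithBot ℕ∞) ≤ Module.supportDim R M := by
  have := h.nontrivial
  obtain ⟨p, hp⟩ := associatedPrimes.nonempty R M
  exact (length_le_ringKrullDim_quotient_of_mem_associatedPrimes
    (fun _ hr => h.mem_maximalIdeal hr) h hp).trans (ringKrullDim_quotient_le_supportDim hp)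

theorem isCohenMacaulayModule_iff_exists_isRegular [Nontrivial M] :
    IsCohenMacaulayModule R M ↔
      ∃ rs : List R, (rs.length : WithBot ℕ∞) = Module.supportDim R M ∧
        (∀ r ∈ rs, r ∈ maximalIdeal R) ∧ IsRegular M rs := by
  obtain ⟨d, hd⟩ := exists_nat_eq_supportDim (R := R) M
  have hle : ∀ rs : List R, IsRegular M rs → (rs.length : ℕ∞) ≤ d := fun rs hrs => by
    have := length_le_supportDim_of_isRegular hrs
    rw [hd] at this
    exact_mod_cast this
  simp only [IsCohenMacaulayModule, not_subsingleton, false_or, moduleDim_eq_supportDim, hd]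
  constructor
  · intro h
    have hdepth : moduleDepth R M = d := by exact_mod_cast h.symm
    have hne : Nonempty {n : ℕ∞ | ∃ rs : List R, (rs.length : ℕ∞) = n ∧
        (∀ x ∈ rs, x ∈ maximalIdeal R) ∧ IsRegular M rs} :=
      ⟨0, [], by simp, by simp, IsRegular.nil R M⟩
    obtain ⟨rs, hlen, hrs⟩ := ENat.sSup_mem_of_nonempty_of_lt_top
      (show moduleDepth R M < ⊤ by rw [hdepth]; exact ENat.natCast_lt_top d)
    refine ⟨rs, ?_, hrs⟩
    have : (rs.length : ℕ∞) = d := hlen.trans hdepth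
    exact_mod_cast this
  · rintro ⟨rs, hlen, hmem, hrs⟩
    have hlen' : (rs.length : ℕ∞) = d := by exact_mod_cast hlen
    have : moduleDepth R M = d := by
      refine le_antisymm (sSup_le ?_) (hlen' ▸ le_sSup ⟨rs, rfl, hmem, hrs⟩)
      rintro _ ⟨rs', rfl, -, hrs'⟩
      exact hle rs' hrs'
    rw [this]
    rfl

/-- A finitely generated module over a Noetherian local ring has a regular sequence modulo which
the maximal ideal is an associated prime. -/
theorem exists_isRegular_maximalIdeal_mem_associatedPrimes [Nontrivial M] :
    ∃ rs : List R, IsRegular M rs ∧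
      maximalIdeal R ∈ associatedPrimes R (M ⧸ (Ideal.ofList rs • ⊤ : Submodule R M)) := by
  obtain ⟨d, hd⟩ := exists_nat_eq_supportDim (R := R) M
  by_contra! hcon
  suffices ∀ n : ℕ, ∃ rs : List R, rs.length = n ∧ IsRegular M rs by
    obtain ⟨rs, hlen, hrs⟩ := this (d + 1)
    have := length_le_supportDim_of_isRegular hrs
    rw [hd, hlen, Nat.cast_le] at this
    omega
  intro n
  induction n with
  | zero => exact ⟨[], rfl, IsRegular.nil R M⟩
  | succ n ih =>
    obtain ⟨rs, hlen, hrs⟩ := ih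
    obtain ⟨x, hxm, hx⟩ :=
      exists_isSMulRegular_of_maximalIdeal_notMem_associatedPrimes (hcon rs hrs)
    refine ⟨rs ++ [x], by simp [hlen], .of_isWeaklyRegular_of_mem_maximalIdeal _ ?_ ?_⟩
    · intro r hr
      obtain hr | rfl : r ∈ rs ∨ r = x := by simpa using hr
      exacts [hrs.mem_maximalIdeal hr, hxm]
    · rw [isWeaklyRegular_append_iff, isWeaklyRegular_singleton_iff]
      exact ⟨hrs.toIsWeaklyRegular, hx⟩

theorem supportDim_eq_zero_of_minimal_associatedPrimes
    (hass : ∀ p ∈ associatedPrimes R M, Minimal (· ∈ associatedPrimes R M) p)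
    (hm : maximalIdeal R ∈ associatedPrimes R M) : Module.supportDim R M = 0 := by
  have : Nontrivial M := by
    by_contra! h
    exact not_isAssociatedPrime_of_subsingleton hm
  have hsub : ∀ p ∈ Module.support R M, p.asIdeal = maximalIdeal R := fun p hp => by
    obtain ⟨q, hq, hqp⟩ := Ideal.exists_minimalPrimes_le
      (Module.mem_support_iff_of_finite.mp hp)
    have hqa := Module.associatedPrimes.minimalPrimes_annihilator_subset_associatedPrimes R M hq
    exact le_antisymm (le_maximalIdeal p.2.ne_top)
      (((hass _ hm).2 hqa (le_maximalIdeal hq.1.1.ne_top)).trans hqp)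
  have : Subsingleton (Module.support R M) :=
    ⟨fun p q => Subtype.ext (PrimeSpectrum.ext ((hsub p p.2).trans (hsub q q.2).symm))⟩
  have : Nonempty (Module.support R M) := Module.nonempty_support_of_nontrivial.to_subtype
  exact Order.krullDim_eq_zero

end

end RegularSequence

/-- Over a Noetherian local ring, a finitely generated module `M` with no
embedded associated primes is Cohen–Macaulay iff `M/aM` is unmixed for every ideal `a` that is
linked with respect to `M`. -/
theorem stmt_17 {R M : Type*} [CommRing R] [IsNoetherianRing R] [IsLocalRing R]
    [AddCommGroup M] [Module R M] [Module.Finite R M]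
    (hass : ∀ p ∈ associatedPrimes R M, Minimal (· ∈ associatedPrimes R M) p) :
    IsCohenMacaulayModule R M ↔
      ∀ a b I : Ideal R, LinkedByWrt M a b I →
        ∀ p ∈ associatedPrimes R (M ⧸ (a • ⊤ : Submodule R M)),
          ringKrullDim (R ⧸ p) = moduleDim R (M ⧸ (a • ⊤ : Submodule R M)) := by
  rcases subsingleton_or_nontrivial M with hM | hM
  · refine ⟨fun _ a b I h => (h.1 (Subsingleton.elim _ _)).elim, fun _ => .inl hM⟩
  rw [isCohenMacaulayModule_iff_exists_isRegular]
  constructor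
  · rintro ⟨rs, hlen, hmem, hrs⟩ a b I ⟨-, -, hI, ⟨xs, hxs, rfl⟩, -, ha⟩ p hp
    rw [moduleDim_eq_supportDim]
    have hdim := Module.supportDim_add_length_eq_supportDim_of_isRegular xs hxs
    have hle := length_le_supportDim_of_isRegular hxs
    rw [← hlen, Nat.cast_le] at hle
    obtain ⟨n, hn⟩ := Nat.exists_eq_add_of_le' hle
    obtain ⟨ys, hylen, hymem, hys⟩ := exists_isRegular_quotient_ofList_smul_top
      (fun _ hr => hxs.mem_maximalIdeal hr) hxs ⟨rs, hn, hmem, hrs⟩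
    have hsupp : Module.supportDim R (M ⧸ (Ideal.ofList xs • ⊤ : Submodule R M)) = n := by
      have := hys.nontrivial
      obtain ⟨d, hd⟩ := exists_nat_eq_supportDim (R := R)
        (M ⧸ (Ideal.ofList xs • ⊤ : Submodule R M))
      rw [hd, ← hlen, hn] at hdim
      rw [hd]
      norm_cast at hdim ⊢
      omega
    have hupper : Module.supportDim R (M ⧸ (a • ⊤ : Submodule R M)) ≤ n := by
      rw [← hsupp]
      exact Module.supportDim_le_of_surjective _ (Submodule.factor_surjective
        (Submodule.smul_mono_left (hI.trans inf_le_left)))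
    refine le_antisymm (ringKrullDim_quotient_le_supportDim hp) (hupper.trans ?_)
    obtain ⟨q, hq, hpq⟩ : ∃ q ∈ associatedPrimes R (M ⧸ (Ideal.ofList xs • ⊤ : Submodule R M)),
        p ≤ q := by
      obtain ⟨hprime, u, hu⟩ := isAssociatedPrime_iff.mp hp
      obtain ⟨u, rfl⟩ := Submodule.Quotient.mk_surjective _ u
      have hmem_p (r : R) : r ∈ p ↔ r • u ∈ (a • ⊤ : Submodule R M) := by
        rw [hu, Submodule.mem_colon_singleton, Submodule.mem_bot, ← Submodule.Quotient.mk_smul,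
          Submodule.Quotient.mk_eq_zero]
      have hu_notMem : u ∉ (a • ⊤ : Submodule R M) := fun h =>
        hprime.ne_top ((Ideal.eq_top_iff_one _).mpr ((hmem_p 1).mpr (by rwa [one_smul])))
      obtain ⟨c, hcb, hc⟩ : ∃ c ∈ b, c • u ∉ (Ideal.ofList xs • ⊤ : Submodule R M) := by
        by_contra! h
        exact hu_notMem (ha ▸ h)
      obtain ⟨q, hq, hle⟩ := exists_le_isAssociatedPrime_of_isNoetherianRing R
        (Submodule.Quotient.mk (c • u) : M ⧸ (Ideal.ofList xs • ⊤ : Submodule R M))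
        (by rwa [Ne, Submodule.Quotient.mk_eq_zero])
      refine ⟨q, hq, fun r hr => hle ?_⟩
      rw [Submodule.mem_colon_singleton, Submodule.mem_bot, ← Submodule.Quotient.mk_smul,
        Submodule.Quotient.mk_eq_zero, smul_comm]
      have := (hmem_p r).mp hr
      rw [ha] at this
      exact this c hcb
    rw [← hylen]
    exact (length_le_ringKrullDim_quotient_of_mem_associatedPrimes hymem hys hq).trans
      (ringKrullDim_le_of_surjective _ (Ideal.Quotient.factor_surjective hpq))
  · intro h
    obtain ⟨rs, hrs, hm⟩ := exists_isRegular_maximalIdeal_mem_associatedPrimes (R := R) (M := M)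
    refine ⟨rs, ?_, fun _ hr => hrs.mem_maximalIdeal hr, hrs⟩
    have hdim := Module.supportDim_add_length_eq_supportDim_of_isRegular rs hrs
    suffices Module.supportDim R (M ⧸ (Ideal.ofList rs • ⊤ : Submodule R M)) = 0 by
      rw [← hdim, this, zero_add]
    rcases List.eq_nil_or_concat' rs with rfl | ⟨xs, x, rfl⟩
    · have e := Submodule.quotEquivOfEqBot (Ideal.ofList ([] : List R) • ⊤ : Submodule R M)
        (by simp)
      rw [LinearEquiv.AssociatedPrimes.eq e] at hm
      rw [Module.supportDim_eq_of_equiv e]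
      exact supportDim_eq_zero_of_minimal_associatedPrimes hass hm
    · rw [← moduleDim_eq_supportDim,
        ← h _ _ _ (linkedByWrt_self_of_isRegular_append_singleton hrs) _ hm]
      let := Ideal.Quotient.field (IsLocalRing.maximalIdeal R)
      exact ringKrullDim_eq_zero_of_field _
end
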